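/- For every natural number n > 6, the spectrum of the alternating group A_n is different from the spectrum of the symmetric group S_n, i.e. ω(A_n) ≠ ω(S_n). -/

import Mathlib

/-- The spectrum of a group: the set of orders of its elements. -/
def groupSpectrum (G : Type*) [Group G] : Set ℕ := {k : ℕ | ∃ g : G, orderOf g = k}

open Finset in
/-- A sum of natural numbers that are at least `2` is at most their product. -/
theorem Finset.sum_le_prod_of_two_le {s : Finset ℕ} (hne : s.Nonempty) (hs : ∀ x ∈ s, 2 ≤ x) :
    ∑ x ∈ s, x ≤ ∏ x ∈ s, x := by
  induction hne using Finset.Nonempty.cons_induction with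
  | singleton a => simp
  | cons a t ha ht ih =>
    rw [sum_cons, prod_cons]
    have h1 := ih fun x hx => hs x (mem_cons_of_mem hx)
    have h2 : 2 ≤ a := hs a (mem_cons_self a t)
    have h3 : 2 ≤ ∑ x ∈ t, x := by
      obtain ⟨b, hb⟩ := ht
      exact (hs b (mem_cons_of_mem hb)).trans
        (single_le_sum (f := fun x => x) (fun _ _ => Nat.zero_le _) hb)
    nlinarith

theorem Nat.sum_primes_dvd_le {T : Finset ℕ} (hT : ∀ p ∈ T, p.Prime) {x : ℕ} (hx : 0 < x) :
    ∑ p ∈ T with p ∣ x, p ≤ x := by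
  rcases (T.filter (· ∣ x)).eq_empty_or_nonempty with h | h
  · simp [h]
  · refine (Finset.sum_le_prod_of_two_le h fun p hp => (hT p (Finset.mem_filter.1 hp).1).two_le).trans
      (Nat.le_of_dvd hx ?_)
    exact Finset.prod_primes_dvd x (fun p hp => (hT p (Finset.mem_filter.1 hp).1).prime)
      fun p hp => (Finset.mem_filter.1 hp).2

/-- Every prime of `T` contributes to the sum of a multiset once for each element it divides. -/
theorem Multiset.sum_mul_countP_dvd_le_sum {T : Finset ℕ} (hT : ∀ p ∈ T, p.Prime)
    (c : Multiset ℕ) (hc : ∀ x ∈ c, 0 < x) :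
    ∑ p ∈ T, p * c.countP (p ∣ ·) ≤ c.sum := by
  induction c using Multiset.induction_on with
  | empty => simp
  | cons a c ih =>
    have h1 := ih fun x hx => hc x (mem_cons_of_mem hx)
    have h2 := Nat.sum_primes_dvd_le hT (hc a (mem_cons_self a c))
    rw [Finset.sum_filter] at h2
    simp only [countP_cons, mul_add, Finset.sum_add_distrib, sum_cons, mul_ite, mul_one, mul_zero]
    omega

theorem Multiset.even_sum_add_card_iff (c : Multiset ℕ) :
    Even (c.sum + card c) ↔ Even (c.countP (2 ∣ ·)) := by
  induction c using Multiset.induction_on with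
  | empty => simp
  | cons a c ih =>
    simp only [Nat.even_iff, countP_cons, sum_cons, card_cons] at *
    split_ifs <;> omega

theorem Equiv.Perm.exists_orderOf_eq_prod_primes {α : Type*} [Fintype α] [DecidableEq α]
    {T : Finset ℕ} (hT : ∀ p ∈ T, p.Prime) (hle : ∑ p ∈ T, p ≤ Fintype.card α) :
    ∃ g : Equiv.Perm α, orderOf g = ∏ p ∈ T, p := by
  obtain ⟨g, hg⟩ := (Equiv.Perm.exists_with_cycleType_iff α (m := T.val)).2
    ⟨T.sum_val.trans_le hle, fun p hp => (hT p hp).two_le⟩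
  refine ⟨g, ?_⟩
  rw [← Equiv.Perm.lcm_cycleType, hg]
  have := Finset.lcm_eq_prod (s := T) (f := id) fun p hp q hq hpq =>
    (Nat.coprime_primes (hT p hp) (hT q hq)).2 hpq
  rwa [Finset.lcm_def, Multiset.map_id] at this

theorem Equiv.Perm.card_ge_of_sign_eq_one {α : Type*} [Fintype α] [DecidableEq α]
    {T : Finset ℕ} (hT : ∀ p ∈ T, p.Prime) (h2 : 2 ∈ T) {g : Equiv.Perm α}
    (hg : orderOf g = ∏ p ∈ T, p) (hs : Equiv.Perm.sign g = 1) :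
    ∑ p ∈ T, p + 2 ≤ Fintype.card α := by
  have hpos : ∀ p ∈ T, 0 < g.cycleType.countP (p ∣ ·) := by
    intro p hp
    rw [Multiset.countP_pos]
    have hd : p ∣ g.cycleType.prod := by
      refine dvd_trans ?_ (Multiset.lcm_dvd.2 fun x hx => Multiset.dvd_prod hx)
      rw [Equiv.Perm.lcm_cycleType, hg]
      exact Finset.dvd_prod_of_mem _ hp
    exact (hT p hp).prime.exists_mem_multiset_dvd hd
  have heven : Even (g.cycleType.countP (2 ∣ ·)) := by
    rw [← Multiset.even_sum_add_card_iff]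
    rw [Equiv.Perm.sign_of_cycleType] at hs
    by_contra h
    rw [Nat.not_even_iff_odd] at h
    rw [h.neg_one_pow] at hs
    exact absurd hs (by decide)
  have htwo : 2 ≤ g.cycleType.countP (2 ∣ ·) := by
    have := hpos 2 h2
    rw [Nat.even_iff] at heven
    omega
  have h3 := Multiset.sum_mul_countP_dvd_le_sum hT g.cycleType
    fun x hx => zero_lt_two.trans_le (Equiv.Perm.two_le_of_mem_cycleType hx)
  have h4 : g.cycleType.sum ≤ Fintype.card α := by
    rw [Equiv.Perm.sum_cycleType]
    exact Finset.card_le_univ _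
  refine le_trans ?_ (h3.trans h4)
  rw [← Finset.add_sum_erase T _ h2, ← Finset.add_sum_erase T _ h2]
  have h5 : ∑ p ∈ T.erase 2, p ≤ ∑ p ∈ T.erase 2, p * g.cycleType.countP (p ∣ ·) :=
    Finset.sum_le_sum fun p hp =>
      Nat.le_mul_of_pos_right p (hpos p (Finset.mem_of_mem_erase hp))
  omega

/-- Sums of distinct odd primes up to a suitable bound miss no two consecutive numbers between `4` and
twice that bound. -/
theorem Nat.exists_bound_sum_odd_primes (m : ℕ) :
    ∃ N, m ≤ N ∧ 13 ≤ N ∧ ∀ k, 5 ≤ k → k ≤ 2 * N + 4 →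
      ∃ S : Finset ℕ, (∀ p ∈ S, p.Prime ∧ p ≠ 2 ∧ p ≤ N) ∧
        ∑ p ∈ S, p ≤ k ∧ k ≤ ∑ p ∈ S, p + 1 := by
  induction m with
  | zero =>
    refine ⟨13, by norm_num, le_rfl, fun k h5 hk => ?_⟩
    have key : ∀ k ∈ Finset.Icc 5 30, ∃ S ∈ ({3, 5, 7, 11, 13} : Finset ℕ).powerset,
        ∑ p ∈ S, p ≤ k ∧ k ≤ ∑ p ∈ S, p + 1 := by decide +kernel
    obtain ⟨S, hS, h⟩ := key k (Finset.mem_Icc.2 ⟨h5, hk⟩)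
    refine ⟨S, fun p hp => ?_, h⟩
    have hp' := Finset.mem_powerset.1 hS hp
    fin_cases hp' <;> norm_num
  | succ m ih =>
    obtain ⟨N, hm, hN, h⟩ := ih
    obtain ⟨q, hq, hNq, hq2⟩ := Nat.exists_prime_lt_and_le_two_mul N (by omega)
    refine ⟨q, by omega, by omega, fun k h5 hk => ?_⟩
    by_cases hkN : k ≤ 2 * N + 4
    · obtain ⟨S, hS, hsum⟩ := h k h5 hkN
      exact ⟨S, fun p hp => ⟨(hS p hp).1, (hS p hp).2.1, (hS p hp).2.2.trans hNq.le⟩, hsum⟩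
    · obtain ⟨S, hS, hsum⟩ := h (k - q) (by omega) (by omega)
      have hqS : q ∉ S := fun hmem => by have := (hS q hmem).2.2; omega
      refine ⟨insert q S, fun p hp => ?_, ?_⟩
      · rcases Finset.mem_insert.1 hp with rfl | hp
        · exact ⟨hq, by omega, le_rfl⟩
        · exact ⟨(hS p hp).1, (hS p hp).2.1, (hS p hp).2.2.trans hNq.le⟩
      · rw [Finset.sum_insert hqS]
        omega

theorem spectrum_alternating_ne_symm
    (n : ℕ) (hn : 6 < n) :
    groupSpectrum (alternatingGroup (Fin n)) ≠ groupSpectrum (Equiv.Perm (Fin n)) := by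
  obtain ⟨N, hnN, -, hN⟩ := Nat.exists_bound_sum_odd_primes n
  obtain ⟨S, hS, hle, hge⟩ := hN (n - 2) (by omega) (by omega)
  have h2S : 2 ∉ S := fun h => (hS 2 h).2.1 rfl
  have hsum : ∑ p ∈ insert 2 S, p = 2 + ∑ p ∈ S, p := Finset.sum_insert h2S
  have hT : ∀ p ∈ insert 2 S, p.Prime := by
    intro p hp
    rcases Finset.mem_insert.1 hp with rfl | hp
    · exact Nat.prime_two
    · exact (hS p hp).1
  intro heq
  have hmem : ∏ p ∈ insert 2 S, p ∈ groupSpectrum (Equiv.Perm (Fin n)) :=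
    Equiv.Perm.exists_orderOf_eq_prod_primes hT (by rw [hsum, Fintype.card_fin]; omega)
  rw [← heq] at hmem
  obtain ⟨g, hg⟩ := hmem
  have := Equiv.Perm.card_ge_of_sign_eq_one hT (Finset.mem_insert_self 2 S)
    ((Subgroup.orderOf_coe g).trans hg) (Equiv.Perm.mem_alternatingGroup.1 g.2)
  rw [hsum, Fintype.card_fin] at this
  omega
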